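/- Let p ≡ 3 (mod 4), let e = 2m with m ≥ 1, and suppose s divides m and m/s ≡ 1 (mod 2). Then for i = 0, 1, the Hamming weight of the codeword of C_{D_i} indexed by (a, b) ∈ F_q^2 equals n_i - T_i(a,b), where n_i = |D_i|; in particular, for a ≠ 0 and b = 0, letting γ be the unique solution in F_q of X^{p^{2l}} + X = -a^{p^l}, the codeword has weight ((p-1)^2/2) p^{2e-3} if Tr(γ^{p^l+1}) = 0 or Tr(γ^{p^l+1}) ∈ C_0^{(2,p)}, and weight ((p-1)^2/2) p^{2e-3} + (p-1) p^{e+m-2} if Tr(γ^{p^l+1}) ∈ C_1^{(2,p)}. -/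

import Mathlib

open scoped BigOperators

noncomputable section

/-- The primitive `p`-th root of unity `ζ_p = exp(2πi/p)`. -/
def zetaP (p : ℕ) : ℂ := Complex.exp (2 * Real.pi * Complex.I / p)

/-- The absolute trace map from `F_q = GF(p^e)` onto `F_p`. -/
def tr (p e : ℕ) [Fact p.Prime] (x : GaloisField p e) : ZMod p :=
  Algebra.trace (ZMod p) (GaloisField p e) x

/-- The Weil sum `S(α, β) = Σ_{x ∈ F_q} ζ_p^{Tr(α x^{p^l+1} + β x)}`. -/
def weilSum (p e l : ℕ) [Fact p.Prime] (α β : GaloisField p e) : ℂ :=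
  letI : Fintype (GaloisField p e) := Fintype.ofFinite _
  ∑ x : GaloisField p e, zetaP p ^ (tr p e (α * x ^ (p ^ l + 1) + β * x)).val

/- The quadratic character `η` of `F_p`, integer-valued:
`η(0) = 0`, `η(x) = 1` for nonzero squares, `η(x) = -1` for nonsquares. -/
open Classical in
def eta (p : ℕ) (x : ZMod p) : ℤ :=
  if x = 0 then 0 else if IsSquare x then 1 else -1

/- The cyclotomic classes of order 2 in `F_p^*`: `cyc p 0` is the set of nonzero
squares `C_0^{(2,p)}`, and `cyc p 1` is the set of nonsquares `C_1^{(2,p)}`. -/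
open Classical in
def cyc (p : ℕ) [Fact p.Prime] (i : ℕ) : Finset (ZMod p) :=
  Finset.univ.filter (fun x => x ≠ 0 ∧ (if i = 0 then IsSquare x else ¬ IsSquare x))

/-- `ψ_3(a) = ((p-1)/2) p^{e-3} Σ_{z1 ∈ F_p^*} ζ_p^{-z1} Σ_{z3 ∈ F_p^*} S(z1, a z3)`. -/
def psi3 (p e l : ℕ) [Fact p.Prime] (a : GaloisField p e) : ℂ :=
  ((p : ℂ) - 1) / 2 * (p : ℂ) ^ ((e : ℤ) - 3) *
    ∑ z1 ∈ ({0}ᶜ : Finset (ZMod p)), zetaP p ^ (-z1).val *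
      ∑ z3 ∈ ({0}ᶜ : Finset (ZMod p)),
        weilSum p e l (algebraMap (ZMod p) (GaloisField p e) z1)
          (a * algebraMap (ZMod p) (GaloisField p e) z3)

/-- `ψ_4^{(i)}(a, b) = p^{e-3} Σ_{c ∈ C_i} Σ_{z1 ∈ F_p^*} ζ_p^{-z1}
      Σ_{z2 ∈ F_p^*} ζ_p^{-c z2} S(z1, -a b⁻¹ z2)`, for `b ∈ F_p^*`. -/
def psi4 (p e l : ℕ) [Fact p.Prime] (i : ℕ) (a : GaloisField p e) (b : ZMod p) : ℂ :=
  (p : ℂ) ^ ((e : ℤ) - 3) *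
    ∑ c ∈ cyc p i, ∑ z1 ∈ ({0}ᶜ : Finset (ZMod p)), zetaP p ^ (-z1).val *
      ∑ z2 ∈ ({0}ᶜ : Finset (ZMod p)), zetaP p ^ (-(c * z2)).val *
        weilSum p e l (algebraMap (ZMod p) (GaloisField p e) z1)
          (-a * algebraMap (ZMod p) (GaloisField p e) (b⁻¹ * z2))

/-- `T_i(a,b) = |{(x1,x2) ∈ F_q² : Tr(x1^{p^l+1}) = 1, Tr(x2) ∈ C_i, Tr(a x1 + b x2) = 0}|`. -/
def Tcount (p e l : ℕ) [Fact p.Prime] (i : ℕ) (a b : GaloisField p e) : ℕ :=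
  Nat.card {x : GaloisField p e × GaloisField p e //
    tr p e (x.1 ^ (p ^ l + 1)) = 1 ∧ tr p e x.2 ∈ cyc p i ∧ tr p e (a * x.1 + b * x.2) = 0}

/-- The defining set `D_i = {(x1,x2) ∈ F_q² : Tr(x1^{p^l+1}) = 1, Tr(x2) ∈ C_i^{(2,p)}}`. -/
def Dset (p e l : ℕ) [Fact p.Prime] (i : ℕ) : Set (GaloisField p e × GaloisField p e) :=
  {x | tr p e (x.1 ^ (p ^ l + 1)) = 1 ∧ tr p e x.2 ∈ cyc p i}

/-- The codeword of `C_{D_i}` indexed by `(a, b) ∈ F_q²`: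
the vector `(Tr(a x1 + b x2))_{(x1,x2) ∈ D_i}`. -/
def codeword (p e l : ℕ) [Fact p.Prime] (i : ℕ) (a b : GaloisField p e) :
    Dset p e l i → ZMod p :=
  fun x => tr p e (a * x.1.1 + b * x.1.2)

/-- The linear code `C_{D_i} = {(Tr(a x1 + b x2))_{(x1,x2) ∈ D_i} : a, b ∈ F_q}`. -/
def code (p e l : ℕ) [Fact p.Prime] (i : ℕ) : Set (Dset p e l i → ZMod p) :=
  Set.range (fun ab : GaloisField p e × GaloisField p e => codeword p e l i ab.1 ab.2)

/-- The Hamming weight of a vector: the number of nonzero coordinates. -/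
def wt {ι : Type*} {p : ℕ} (c : ι → ZMod p) : ℕ := Nat.card {x : ι // c x ≠ 0}

section Helpers
open Classical
set_option linter.unusedSectionVars false

variable {p : ℕ} [Fact p.Prime] {F : Type*} [Field F] [Fintype F] [Algebra (ZMod p) F] [CharP F p]

lemma trace_pow_p (l : ℕ) (x : F) :
    Algebra.trace (ZMod p) F (x ^ p ^ l) = Algebra.trace (ZMod p) F x := by
  induction l with
  | zero => simp
  | succ k ih =>
    have h := Algebra.trace_eq_of_algEquiv (FiniteField.frobeniusAlgEquivOfAlgebraic (ZMod p) F)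
      (x ^ p ^ k)
    rw [← ih, ← h, pow_succ, pow_mul]
    simp [ZMod.card]

lemma tr_nondeg (w : F) (h : ∀ x, Algebra.trace (ZMod p) F (w * x) = 0) : w = 0 := by
  by_contra hw
  obtain ⟨y, hy⟩ := Algebra.trace_surjective (ZMod p) F 1
  have := h (w⁻¹ * y)
  rw [mul_inv_cancel_left₀ hw, hy] at this
  exact one_ne_zero this

/-- nondegeneracy of the linearised polynomial -/
lemma lin_nondeg (hp2 : p ≠ 2) (l e j k : ℕ) (hcard : Fintype.card F = p ^ e)
    (hj : Odd j) (hjk : 2 * l * j = e * k) (x : F) (hx : x ^ p ^ (2 * l) = -x) : x = 0 := by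
  have hpo : Odd p := (Fact.out : p.Prime).odd_of_ne_two hp2
  have key : ∀ n : ℕ, x ^ p ^ (2 * l * n) = (-1) ^ n * x := by
    intro n
    induction n with
    | zero => simp
    | succ n ih =>
      rw [Nat.mul_succ, pow_add, pow_mul, ih, mul_pow, hx, ← pow_mul, mul_comm n, pow_mul,
        (hpo.pow).neg_one_pow]
      ring
  have h1 := key j
  rw [hjk, pow_mul, ← hcard, FiniteField.pow_card_pow, hj.neg_one_pow] at h1
  have h2 : (2 : F) * x = 0 := by linear_combination h1
  rcases mul_eq_zero.1 h2 with h | h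
  · exfalso
    have := (CharP.cast_eq_zero_iff F p 2).1 (by exact_mod_cast h)
    exact hp2 ((Nat.prime_dvd_prime_iff_eq Fact.out Nat.prime_two).1 this)
  · exact h

lemma add_pow_pp (n : ℕ) (x y : F) : (x + y) ^ p ^ n = x ^ p ^ n + y ^ p ^ n :=
  add_pow_char_pow x y p n

lemma lin_bij (l : ℕ) (hnd : ∀ x : F, x ^ p ^ (2 * l) = -x → x = 0) (c : F) :
    ∃! γ : F, γ ^ p ^ (2 * l) + γ = c := by
  have hinj : Function.Injective (fun x : F => x ^ p ^ (2 * l) + x) := by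
    intro x y hxy
    have hxy : x ^ p ^ (2 * l) + x = y ^ p ^ (2 * l) + y := hxy
    have := hnd (x - y) (by rw [sub_pow_char_pow]; linear_combination hxy)
    exact sub_eq_zero.1 this
  exact (Function.bijective_iff_existsUnique _).1 (Finite.injective_iff_bijective.1 hinj) c

/-- polar form expansion -/
lemma Q_add (l : ℕ) (x y : F) :
    Algebra.trace (ZMod p) F ((x + y) ^ (p ^ l + 1)) =
      Algebra.trace (ZMod p) F (x ^ (p ^ l + 1)) + Algebra.trace (ZMod p) F (y ^ (p ^ l + 1))
      + Algebra.trace (ZMod p) F ((x ^ p ^ (2 * l) + x) * y ^ p ^ l) := by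
  have h1 : (x + y) ^ (p ^ l + 1) = x ^ (p ^ l + 1) + y ^ (p ^ l + 1) + x ^ p ^ l * y
      + x * y ^ p ^ l := by
    rw [pow_succ, add_pow_pp]; ring
  have h2 : x ^ p ^ (2 * l) * y ^ p ^ l = (x ^ p ^ l * y) ^ p ^ l := by
    rw [mul_pow, ← pow_mul, ← pow_add, two_mul]
  rw [h1, add_mul, h2, map_add, map_add, map_add, map_add, trace_pow_p]
  ring

lemma zmod_pow_pp (l : ℕ) (w : ZMod p) : w ^ p ^ l = w := by
  simp

lemma Q_smul (l : ℕ) (w : ZMod p) (x : F) :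
    Algebra.trace (ZMod p) F ((w • x) ^ (p ^ l + 1)) =
      w ^ 2 * Algebra.trace (ZMod p) F (x ^ (p ^ l + 1)) := by
  rw [smul_pow, map_smul, pow_succ w, zmod_pow_pp, smul_eq_mul]; ring

/-- sums of the standard character over a linear functional -/
lemma sum_char_trace (w : F) :
    ∑ x : F, ZMod.stdAddChar (Algebra.trace (ZMod p) F (w * x)) =
      if w = 0 then (Fintype.card F : ℂ) else 0 := by
  split_ifs with h
  · simp [h]
  · have := AddChar.sum_eq_zero_of_ne_one (ψ := (ZMod.stdAddChar (N := p)).compAddMonoidHom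
      ((Algebra.trace (ZMod p) F).toAddMonoidHom.comp (AddMonoidHom.mulLeft w))) ?_
    · simpa using this
    · intro h1
      obtain ⟨y, hy⟩ := Algebra.trace_surjective (ZMod p) F 1
      have h2 := DFunLike.congr_fun h1 (w⁻¹ * y)
      simp only [AddChar.compAddMonoidHom_apply, AddMonoidHom.comp_apply,
        AddMonoidHom.coe_mulLeft, mul_inv_cancel_left₀ h, LinearMap.toAddMonoidHom_coe, hy,
        AddChar.one_apply] at h2
      have h3 := ZMod.injective_stdAddChar (N := p) (h2.trans (AddChar.map_zero_eq_one _).symm)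
      exact one_ne_zero h3

lemma sum_char_zmod (b : ZMod p) :
    ∑ x : ZMod p, ZMod.stdAddChar (x * b) = if b = 0 then (p : ℂ) else 0 := by
  rw [AddChar.sum_mulShift b (ZMod.isPrimitive_stdAddChar p)]
  split_ifs <;> simp [ZMod.card]

/-- existence of the special element -/
lemma exists_t (hp2 : p ≠ 2) (s m' l' : ℕ) (hs : 0 < s) (hm' : 0 < m') (hl' : Odd l')
    (hcard : Fintype.card F = p ^ (2 * s * m')) :
    ∃ t : Fˣ, orderOf t = 2 * (p ^ s + 1) ∧ (t : F) ^ (p ^ (s * l') + 1) = -1 := by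
  have hp : p.Prime := Fact.out
  have hpo : Odd p := hp.odd_of_ne_two hp2
  have hdvd : 2 * (p ^ s + 1) ∣ Nat.card Fˣ := by
    rw [Nat.card_units, Nat.card_eq_fintype_card, hcard]
    have h1 : p ^ (2 * s) - 1 ∣ p ^ (2 * s * m') - 1 := Nat.pow_sub_one_dvd_pow_sub_one p ⟨m', rfl⟩
    refine dvd_trans ?_ h1
    have h2 : p ^ (2 * s) - 1 = (p ^ s - 1) * (p ^ s + 1) := by
      rw [mul_comm 2 s, pow_mul, mul_comm]; simpa using Nat.sq_sub_sq (p ^ s) 1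
    rw [h2]
    refine mul_dvd_mul ?_ dvd_rfl
    obtain ⟨r, hr⟩ := hpo.pow (n := s)
    exact ⟨r, by omega⟩
  obtain ⟨g, hg⟩ := IsCyclic.exists_ofOrder_eq_natCard (α := Fˣ)
  obtain ⟨r, hr⟩ := hdvd
  have hr0 : r ≠ 0 := by
    rintro rfl
    have : 0 < Nat.card Fˣ := Nat.card_pos
    omega
  have ho : orderOf (g ^ r) = 2 * (p ^ s + 1) := by
    rw [orderOf_pow_of_dvd hr0 (by rw [hg, hr]; exact dvd_mul_left _ _), hg, hr]
    exact Nat.mul_div_cancel _ (Nat.pos_of_ne_zero hr0)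
  refine ⟨g ^ r, ho, ?_⟩
  set t : Fˣ := g ^ r
  have h1 : (t : F) ^ (p ^ s + 1) = -1 := by
    have h2 : ((t : F) ^ (p ^ s + 1)) ^ 2 = 1 := by
      rw [← pow_mul, mul_comm, ← ho]
      rw [← Units.val_pow_eq_pow_val, pow_orderOf_eq_one, Units.val_one]
    rcases sq_eq_sq_iff_eq_or_eq_neg.1 (h2.trans (one_pow 2).symm) with h | h
    · exfalso
      have h3 : t ^ (p ^ s + 1) = 1 := by
        ext; simpa using h
      have := Nat.le_of_dvd (Nat.succ_pos _) (orderOf_dvd_of_pow_eq_one h3)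
      rw [ho] at this
      have : 0 < p ^ s := pow_pos hp.pos s
      omega
    · exact h
  have ht0 : (t : F) ≠ 0 := t.ne_zero
  have h2 : (t : F) ^ p ^ (2 * s) = t := by
    have h3 : ((t : F) ^ p ^ s * t) ^ p ^ s = -1 := by
      rw [← pow_succ, h1, hpo.pow.neg_one_pow]
    rw [mul_pow, ← pow_mul, ← pow_add p, ← two_mul] at h3
    rw [pow_succ] at h1
    have h4 : (t : F) ^ p ^ s ≠ 0 := pow_ne_zero _ ht0
    apply mul_right_cancel₀ h4
    rw [h3, ← h1, mul_comm]
  obtain ⟨j, rfl⟩ := hl'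
  have h5 : ∀ j : ℕ, (t : F) ^ p ^ (s * (2 * j + 1)) = t ^ p ^ s := by
    intro j
    induction j with
    | zero => simp
    | succ j ih =>
      have : s * (2 * (j + 1) + 1) = 2 * s + s * (2 * j + 1) := by ring
      rw [this, pow_add, pow_mul, h2, ih]
  rw [pow_succ, h5, ← pow_succ, h1]

/-- The quadratic form `x ↦ Tr(x^{p^l+1})`. -/
def QF (p : ℕ) [Fact p.Prime] {F : Type*} [Field F] [Algebra (ZMod p) F] (l : ℕ) (x : F) :
    ZMod p := Algebra.trace (ZMod p) F (x ^ (p ^ l + 1))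

/-- The number of `x` with `Q x = d`. -/
def NQ (p : ℕ) [Fact p.Prime] (F : Type*) [Field F] [Fintype F] [Algebra (ZMod p) F] (l : ℕ)
    (d : ZMod p) : ℕ := (Finset.univ.filter (fun x : F => QF p l x = d)).card

lemma NQ_scale (l : ℕ) (u : Fˣ) (c : ZMod p) (hc : c ≠ 0)
    (h : ∀ x : F, QF p l (u * x) = c * QF p l x) (d : ZMod p) :
    NQ p F l (c * d) = NQ p F l d := by
  symm
  apply Finset.card_bij (fun x _ => (u : F) * x)
  · intro x hx
    simp only [Finset.mem_filter, Finset.mem_univ, true_and] at hx ⊢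
    rw [h, hx]
  · intro x _ y _ hxy
    exact mul_left_cancel₀ u.ne_zero hxy
  · intro y hy
    simp only [Finset.mem_filter, Finset.mem_univ, true_and] at hy
    refine ⟨(u⁻¹ : Fˣ) * y, ?_, by simp⟩
    simp only [Finset.mem_filter, Finset.mem_univ, true_and]
    have := h ((u⁻¹ : Fˣ) * y)
    rw [Units.mul_inv_cancel_left, hy] at this
    exact (mul_left_cancel₀ hc this).symm

lemma not_sq_neg_one (hp : p % 4 = 3) : ¬ IsSquare (-1 : ZMod p) := by
  rw [ZMod.exists_sq_eq_neg_one_iff]; simpa using hp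

lemma sq_or_neg_sq (hp : p % 4 = 3) (d : ZMod p) : IsSquare d ∨ IsSquare (-d) := by
  by_cases hd : d = 0
  · left; simp [hd]
  by_contra! h
  have hp2 : ringChar (ZMod p) ≠ 2 := by
    rw [ZMod.ringChar_zmod_n]; omega
  have h1 := (quadraticChar_neg_one_iff_not_isSquare (F := ZMod p)).2 h.1
  have h2 := (quadraticChar_neg_one_iff_not_isSquare (F := ZMod p)).2 h.2
  have h3 := (quadraticChar_neg_one_iff_not_isSquare (F := ZMod p)).2 (not_sq_neg_one hp)
  have h4 : quadraticChar (ZMod p) (-d) = quadraticChar (ZMod p) (-1) * quadraticChar (ZMod p) d := by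
    rw [← map_mul]; simp
  rw [h1, h2, h3] at h4
  norm_num at h4

lemma NQ_const (hp : p % 4 = 3) (l : ℕ) (t : Fˣ) (ht : (t : F) ^ (p ^ l + 1) = -1)
    (d : ZMod p) (hd : d ≠ 0) : NQ p F l d = NQ p F l 1 := by
  have hsq : ∀ w : ZMod p, w ≠ 0 → ∀ d, NQ p F l (w ^ 2 * d) = NQ p F l d := by
    intro w hw d
    have hw' : algebraMap (ZMod p) F w ≠ 0 := by simpa using hw
    refine NQ_scale l (Units.mk0 _ hw') (w ^ 2) (pow_ne_zero _ hw) ?_ d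
    intro x
    rw [Units.val_mk0, ← Algebra.smul_def]
    exact Q_smul l w x
  have hneg : ∀ d, NQ p F l (-1 * d) = NQ p F l d := by
    refine fun d => NQ_scale l t (-1) (by simp) ?_ d
    intro x
    rw [QF, mul_pow, ht, QF]; simp
  rcases sq_or_neg_sq hp d with ⟨w, hw⟩ | ⟨w, hw⟩
  · have hw0 : w ≠ 0 := by rintro rfl; simp at hw; exact hd hw
    have := hsq w hw0 1
    rwa [mul_one, sq, ← hw] at this
  · have hw0 : w ≠ 0 := by rintro rfl; simp at hw; exact hd hw
    have := hsq w hw0 1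
    rw [mul_one, sq, ← hw] at this
    rw [← this, ← hneg d]; simp

lemma units_count_dvd (l K : ℕ) (g : Fˣ) (hg : orderOf g = K) (hgl : g ^ (p ^ l + 1) = 1)
    (d : ZMod p) : K ∣ (Finset.univ.filter (fun u : Fˣ => QF p l (u : F) = d)).card := by
  rw [Finset.card_eq_sum_card_fiberwise (f := fun u : Fˣ => u ^ (p ^ l + 1)) (t := Finset.univ)
    (by intro x _; simp)]
  apply Finset.dvd_sum
  intro y _
  rw [Finset.filter_filter]
  by_cases hy : Algebra.trace (ZMod p) F (y : F) = d ∧ y ∈ Set.range (powMonoidHom (α := Fˣ) (p ^ l + 1))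
  · have h1 : (Finset.univ.filter (fun u : Fˣ => QF p l (u : F) = d ∧ u ^ (p ^ l + 1) = y)) =
        Finset.univ.filter (fun u : Fˣ => powMonoidHom (α := Fˣ) (p ^ l + 1) u = y) := by
      ext u
      simp only [Finset.mem_filter, Finset.mem_univ, true_and, powMonoidHom_apply]
      constructor
      · exact fun h => h.2
      · intro h
        refine ⟨?_, h⟩
        rw [QF, ← Units.val_pow_eq_pow_val, h, hy.1]
    rw [h1, MonoidHom.card_fiber_eq_of_mem_range _ hy.2 (y := 1) ⟨1, by simp⟩]
    have h2 : Nat.card (powMonoidHom (α := Fˣ) (p ^ l + 1)).ker =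
        (Finset.univ.filter (fun u : Fˣ => powMonoidHom (α := Fˣ) (p ^ l + 1) u = 1)).card := by
      rw [Nat.card_eq_fintype_card]
      exact Fintype.card_of_subtype _ (by intro x; simp [MonoidHom.mem_ker])
    rw [← h2, ← hg]
    exact Subgroup.orderOf_dvd_natCard _ (by simpa [MonoidHom.mem_ker] using hgl)
  · convert dvd_zero K
    rw [Finset.card_eq_zero, Finset.filter_eq_empty_iff]
    rintro u - ⟨h1, h2⟩
    apply hy
    refine ⟨?_, u, h2⟩
    rw [← h2, ← h1, QF, Units.val_pow_eq_pow_val]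

lemma NQ_eq_units (l : ℕ) (d : ZMod p) :
    NQ p F l d = (Finset.univ.filter (fun u : Fˣ => QF p l (u : F) = d)).card
      + if d = 0 then 1 else 0 := by
  have h0 : QF p l (0 : F) = 0 := by simp [QF]
  have h1 : (Finset.univ.filter (fun u : Fˣ => QF p l (u : F) = d)).card =
      ((Finset.univ.filter (fun x : F => QF p l x = d)).erase 0).card := by
    apply Finset.card_bij (fun (u : Fˣ) _ => (u : F))
    · intro u hu
      simpa using hu
    · intro u _ v _ h
      exact Units.ext h
    · intro x hx
      simp only [Finset.mem_erase, Finset.mem_filter, Finset.mem_univ, true_and] at hx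
      exact ⟨Units.mk0 x hx.1, by simpa using hx.2, rfl⟩
  rw [h1, NQ]
  split_ifs with h
  · rw [Finset.card_erase_add_one (by simp [h0, h])]
  · rw [Finset.erase_eq_of_notMem (by simpa [h0] using Ne.symm h), add_zero]

lemma sum_char_Q (l : ℕ) (hN : ∀ d : ZMod p, d ≠ 0 → NQ p F l d = NQ p F l 1)
    (z : ZMod p) (hz : z ≠ 0) :
    ∑ x : F, ZMod.stdAddChar (z * QF p l x) = (((NQ p F l 0 : ℤ) - NQ p F l 1 : ℤ) : ℂ) := by
  have h1 : ∑ x : F, ZMod.stdAddChar (z * QF p l x) =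
      ∑ d : ZMod p, (NQ p F l d : ℂ) * ZMod.stdAddChar (d * z) := by
    rw [← Finset.sum_fiberwise (s := Finset.univ) (g := fun x : F => QF p l x)]
    refine Finset.sum_congr rfl fun d _ => ?_
    rw [NQ, ← nsmul_eq_mul, ← Finset.sum_const]
    refine Finset.sum_congr rfl fun x hx => ?_
    rw [(Finset.mem_filter.1 hx).2, mul_comm]
  have h2 : ∀ d : ZMod p, (NQ p F l d : ℂ) * ZMod.stdAddChar (d * z) =
      (NQ p F l 1 : ℂ) * ZMod.stdAddChar (d * z) +
        if d = 0 then ((NQ p F l 0 : ℂ) - NQ p F l 1) else 0 := by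
    intro d
    split_ifs with h
    · simp [h]
    · rw [hN d h, add_zero]
  rw [h1, Finset.sum_congr rfl fun d _ => h2 d, Finset.sum_add_distrib, ← Finset.mul_sum,
    sum_char_zmod, if_neg hz]
  simp

lemma S_sq (l : ℕ) (hnd : ∀ x : F, x ^ p ^ (2 * l) = -x → x = 0) :
    (∑ x : F, ZMod.stdAddChar (1 * QF p l x)) * (∑ x : F, ZMod.stdAddChar (-1 * QF p l x)) =
      (Fintype.card F : ℂ) := by
  have hbij : Function.Bijective (fun x : F => x ^ p ^ l) := by
    have : Function.Injective (fun x : F => x ^ p ^ l) := by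
      intro x y hxy
      have hxy : x ^ p ^ l = y ^ p ^ l := hxy
      have : (x - y) ^ p ^ l = 0 := by rw [sub_pow_char_pow, hxy, sub_self]
      exact sub_eq_zero.1 (pow_eq_zero_iff (by have := (Fact.out : p.Prime).pos; positivity) |>.1 this)
    exact Finite.injective_iff_bijective.1 this
  rw [mul_comm, Finset.sum_mul_sum]
  have h1 : ∀ y : F, ∑ x : F, ZMod.stdAddChar (-1 * QF p l y) * ZMod.stdAddChar (1 * QF p l x) =
      ∑ h : F, ZMod.stdAddChar (QF p l h) *
        ZMod.stdAddChar (Algebra.trace (ZMod p) F ((h ^ p ^ (2 * l) + h) * y ^ p ^ l)) := by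
    intro y
    rw [← Equiv.sum_comp (Equiv.addRight y)]
    refine Finset.sum_congr rfl fun h _ => ?_
    rw [Equiv.coe_addRight, ← AddChar.map_add_eq_mul, ← AddChar.map_add_eq_mul]
    congr 1
    have := Q_add (p := p) l h y
    simp only [QF]
    rw [this]; ring
  rw [Finset.sum_congr rfl fun y _ => h1 y, Finset.sum_comm]
  have h2 : ∀ h : F, ∑ y : F, ZMod.stdAddChar (QF p l h) *
        ZMod.stdAddChar (Algebra.trace (ZMod p) F ((h ^ p ^ (2 * l) + h) * y ^ p ^ l)) =
      if h = 0 then (Fintype.card F : ℂ) else 0 := by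
    intro h
    rw [← Finset.mul_sum, hbij.sum_comp (fun y => (ZMod.stdAddChar
      (Algebra.trace (ZMod p) F ((h ^ p ^ (2 * l) + h) * y)) : ℂ)), sum_char_trace]
    have hp0 := (Fact.out : p.Prime).ne_zero
    by_cases hh : h = 0
    · simp [hh, QF, hp0]
    · rw [if_neg hh, if_neg (fun h' => hh (hnd h (eq_neg_of_add_eq_zero_left h'))), mul_zero]
  rw [Finset.sum_congr rfl fun y _ => h2 y]
  simp

lemma S_value (hp : p % 4 = 3) (l s m m' l' : ℕ) (hs : 0 < s) (hm' : Odd m') (hl' : Odd l')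
    (hm : m = s * m') (hl : l = s * l') (hcard : Fintype.card F = p ^ (2 * m)) 
    (hnd : ∀ x : F, x ^ p ^ (2 * l) = -x → x = 0) :
    (∀ d : ZMod p, d ≠ 0 → NQ p F l d = NQ p F l 1) ∧
      (NQ p F l 0 : ℤ) - NQ p F l 1 = - (p : ℤ) ^ m := by
  have hp2 : p ≠ 2 := by rintro rfl; omega
  obtain ⟨t, ho, ht⟩ := exists_t (F := F) hp2 s m' l' hs hm'.pos hl' (by rw [hcard, hm, mul_assoc])
  rw [← hl] at ht
  have hN := NQ_const hp l t ht
  refine ⟨hN, ?_⟩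
  have hsq := S_sq (F := F) (p := p) l hnd
  rw [sum_char_Q l hN 1 one_ne_zero, sum_char_Q l hN (-1) (by simp), hcard] at hsq
  have hsq' : ((NQ p F l 0 : ℤ) - NQ p F l 1) * ((NQ p F l 0 : ℤ) - NQ p F l 1) = (p : ℤ) ^ (2 * m) := by
    exact_mod_cast hsq
  have hK : orderOf (t ^ 2) = p ^ s + 1 := by
    rw [orderOf_pow_of_dvd two_ne_zero (by rw [ho]; exact dvd_mul_right _ _), ho]; simp
  have htl : (t ^ 2) ^ (p ^ l + 1) = 1 := by
    ext
    rw [← pow_mul, mul_comm, pow_mul]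
    push_cast
    rw [ht]; simp
  obtain ⟨c0, h0⟩ := units_count_dvd (p := p) l _ _ hK htl 0
  obtain ⟨c1, h1⟩ := units_count_dvd (p := p) l _ _ hK htl 1
  have e0 := NQ_eq_units (F := F) (p := p) l 0
  have e1 := NQ_eq_units (F := F) (p := p) l 1
  rw [h0, if_pos rfl] at e0
  rw [h1, if_neg one_ne_zero] at e1
  have hd : p ^ s + 1 ∣ p ^ m + 1 := by
    have := hm'.nat_add_dvd_pow_add_pow (p ^ s) 1
    rwa [one_pow, ← pow_mul, ← hm] at this
  have hfac : ((NQ p F l 0 : ℤ) - NQ p F l 1) = (p : ℤ) ^ m ∨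
      ((NQ p F l 0 : ℤ) - NQ p F l 1) = - (p : ℤ) ^ m := by
    apply sq_eq_sq_iff_eq_or_eq_neg.1
    rw [sq, hsq', ← pow_mul, mul_comm]
  rcases hfac with h | h
  · exfalso
    have hd' : ((p : ℤ) ^ s + 1) ∣ (p : ℤ) ^ m + 1 := by exact_mod_cast hd
    have hd2 : ((p : ℤ) ^ s + 1) ∣ (p : ℤ) ^ m - 1 := by
      rw [← h, e0, e1]
      refine ⟨(c0 : ℤ) - c1, ?_⟩
      push_cast; ring
    have hd3 : ((p : ℤ) ^ s + 1) ∣ 2 := by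
      have := dvd_sub hd' hd2
      ring_nf at this ⊢
      exact this
    have := Int.le_of_dvd (by norm_num) hd3
    have h3 : (p : ℤ) ≤ (p : ℤ) ^ s := by
      exact_mod_cast Nat.le_self_pow hs.ne' p
    have : 3 ≤ p := by omega
    omega
  · exact h

lemma Q_shift (l : ℕ) (a γ : F) (hγ : γ ^ p ^ (2 * l) + γ = -a ^ p ^ l) (u : ZMod p) (x : F) :
    QF p l (x + (-u) • γ) =
      QF p l x + u * Algebra.trace (ZMod p) F (a * x) + u ^ 2 * QF p l γ := by
  have h1 := Q_add (p := p) l ((-u) • γ) x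
  have h2 := Q_smul (p := p) l (-u) γ
  have h3 : ((-u) • γ) ^ p ^ (2 * l) + (-u) • γ = (-u) • (-a ^ p ^ l) := by
    rw [smul_pow, zmod_pow_pp, ← smul_add, hγ]
  rw [h2, h3, smul_mul_assoc, map_smul, neg_mul, ← mul_pow, map_neg, trace_pow_p] at h1
  simp only [QF]
  rw [add_comm x, h1, smul_eq_mul]; ring

lemma count_M (l m : ℕ) (a γ : F) (ha : a ≠ 0) (hγ : γ ^ p ^ (2 * l) + γ = -a ^ p ^ l)
    (hS : ∀ z : ZMod p, z ≠ 0 → ∑ x : F, ZMod.stdAddChar (z * QF p l x) = -(p : ℂ) ^ m) :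
    (p : ℤ) ^ 2 * (Finset.univ.filter (fun x : F => QF p l x = 1 ∧
        Algebra.trace (ZMod p) F (a * x) = 0)).card =
      Fintype.card F - (p : ℤ) ^ m * (p * (Finset.univ.filter
        (fun u : ZMod p => QF p l γ * u ^ 2 = -1)).card - p) := by
  have hA : ((p : ℂ) ^ 2 * (Finset.univ.filter (fun x : F => QF p l x = 1 ∧
        Algebra.trace (ZMod p) F (a * x) = 0)).card) =
      ∑ z : ZMod p, ∑ y : ZMod p, ∑ x : F, ZMod.stdAddChar (z * (QF p l x - 1)) *
        ZMod.stdAddChar (y * Algebra.trace (ZMod p) F (a * x)) := by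
    have h1 : ∀ x : F, ∑ z : ZMod p, ∑ y : ZMod p, (ZMod.stdAddChar (z * (QF p l x - 1)) : ℂ) *
        ZMod.stdAddChar (y * Algebra.trace (ZMod p) F (a * x)) =
        if (QF p l x = 1 ∧ Algebra.trace (ZMod p) F (a * x) = 0) then (p : ℂ) ^ 2 else 0 := by
      intro x
      rw [← Finset.sum_mul_sum, sum_char_zmod, sum_char_zmod]
      simp only [sub_eq_zero]
      by_cases h : QF p l x = 1 <;> by_cases h' : Algebra.trace (ZMod p) F (a * x) = 0 <;>
        simp [h, h', sq]
    have h2 : ∀ z : ZMod p, ∑ y : ZMod p, ∑ x : F, (ZMod.stdAddChar (z * (QF p l x - 1)) : ℂ) *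
        ZMod.stdAddChar (y * Algebra.trace (ZMod p) F (a * x)) =
        ∑ x : F, ∑ y : ZMod p, (ZMod.stdAddChar (z * (QF p l x - 1)) : ℂ) *
        ZMod.stdAddChar (y * Algebra.trace (ZMod p) F (a * x)) := fun z => Finset.sum_comm
    rw [Finset.sum_congr rfl fun z _ => h2 z, Finset.sum_comm,
      Finset.sum_congr rfl fun x _ => h1 x, ← Finset.sum_filter, Finset.sum_const, nsmul_eq_mul,
      mul_comm]
  have hB : ∀ z : ZMod p, z ≠ 0 → ∑ y : ZMod p, ∑ x : F,
      (ZMod.stdAddChar (z * (QF p l x - 1)) : ℂ) *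
        ZMod.stdAddChar (y * Algebra.trace (ZMod p) F (a * x)) =
      ∑ u : ZMod p, -(p : ℂ) ^ m * ZMod.stdAddChar (z * (-(1 + QF p l γ * u ^ 2))) := by
    intro z hz
    rw [← Equiv.sum_comp (Equiv.mulLeft₀ z hz)]
    refine Finset.sum_congr rfl fun u _ => ?_
    have hR : ∑ x : F, (ZMod.stdAddChar (z * QF p l (x + (-u) • γ)) : ℂ) =
        ∑ x : F, ZMod.stdAddChar (z * QF p l x) :=
      Equiv.sum_comp (Equiv.addRight ((-u) • γ)) (fun x => (ZMod.stdAddChar (z * QF p l x) : ℂ))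
    rw [← hS z hz, ← hR, Finset.sum_mul]
    refine Finset.sum_congr rfl fun x _ => ?_
    rw [← AddChar.map_add_eq_mul, ← AddChar.map_add_eq_mul]
    congr 1
    rw [Q_shift l a γ hγ u x, Equiv.mulLeft₀_apply]
    ring
  have hC : ∑ y : ZMod p, ∑ x : F,
      (ZMod.stdAddChar ((0 : ZMod p) * (QF p l x - 1)) : ℂ) *
        ZMod.stdAddChar (y * Algebra.trace (ZMod p) F (a * x)) = Fintype.card F := by
    have : ∀ y : ZMod p, ∑ x : F,
      (ZMod.stdAddChar ((0 : ZMod p) * (QF p l x - 1)) : ℂ) *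
        ZMod.stdAddChar (y * Algebra.trace (ZMod p) F (a * x)) =
        if y = 0 then (Fintype.card F : ℂ) else 0 := by
      intro y
      have h := sum_char_trace (p := p) (y • a)
      simp only [smul_mul_assoc, map_smul, smul_eq_mul, ha, or_false] at h
      simpa [ha] using h
    rw [Finset.sum_congr rfl fun y _ => this y]; simp
  have hD : ∀ u : ZMod p, ∑ z ∈ Finset.univ.erase (0 : ZMod p),
      (ZMod.stdAddChar (z * (-(1 + QF p l γ * u ^ 2))) : ℂ) =
      (if QF p l γ * u ^ 2 = -1 then (p : ℂ) else 0) - 1 := by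
    intro u
    have h := sum_char_zmod (-(1 + QF p l γ * u ^ 2))
    rw [← Finset.add_sum_erase _ _ (Finset.mem_univ (0 : ZMod p))] at h
    have hiff : (-(1 + QF p l γ * u ^ 2) = 0) ↔ QF p l γ * u ^ 2 = -1 := by
      rw [neg_eq_zero, add_comm, add_eq_zero_iff_eq_neg]
    simp only [hiff] at h
    rw [← h]; simp
  rw [← Finset.add_sum_erase _ _ (Finset.mem_univ (0 : ZMod p)), hC,
    Finset.sum_congr rfl fun z hz => hB z (Finset.ne_of_mem_erase hz), Finset.sum_comm] at hA
  simp only [← Finset.mul_sum] at hA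
  rw [Finset.sum_congr rfl fun u _ => hD u, Finset.sum_sub_distrib, ← Finset.sum_filter,
    Finset.sum_const, Finset.sum_const, Finset.card_univ, ZMod.card, nsmul_eq_mul, nsmul_eq_mul] at hA
  have : ((((p : ℤ) ^ 2 * (Finset.univ.filter (fun x : F => QF p l x = 1 ∧
        Algebra.trace (ZMod p) F (a * x) = 0)).card : ℤ)) : ℂ) =
      ((Fintype.card F - (p : ℤ) ^ m * (p * (Finset.univ.filter
        (fun u : ZMod p => QF p l γ * u ^ 2 = -1)).card - p) : ℤ) : ℂ) := by
    push_cast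
    rw [hA]; ring
  exact_mod_cast this

lemma NQ_sum (l : ℕ) (hN : ∀ d : ZMod p, d ≠ 0 → NQ p F l d = NQ p F l 1) :
    (NQ p F l 0 : ℤ) + (p - 1) * NQ p F l 1 = Fintype.card F := by
  have h : (Finset.univ : Finset F).card = ∑ d : ZMod p, NQ p F l d :=
    Finset.card_eq_sum_card_fiberwise (s := (Finset.univ : Finset F))
      (f := fun x : F => QF p l x) (t := Finset.univ) (by intro x _; simp)
  rw [← Finset.add_sum_erase _ _ (Finset.mem_univ (0 : ZMod p)),
    Finset.sum_congr rfl fun d hd => hN d (Finset.ne_of_mem_erase hd), Finset.sum_const,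
    Finset.card_erase_of_mem (Finset.mem_univ _), Finset.card_univ, Finset.card_univ, ZMod.card,
    smul_eq_mul] at h
  have hp1 : 1 ≤ p := (Fact.out : p.Prime).one_le
  rw [h]
  push_cast [hp1]
  ring

lemma trace_fiber (C : Finset (ZMod p)) :
    p * (Finset.univ.filter (fun x : F => Algebra.trace (ZMod p) F x ∈ C)).card =
      C.card * Fintype.card F := by
  have hf : ∀ d : ZMod p, (Finset.univ.filter (fun x : F => Algebra.trace (ZMod p) F x = d)).card =
      (Finset.univ.filter (fun x : F => Algebra.trace (ZMod p) F x = 0)).card := fun d =>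
    AddMonoidHom.card_fiber_eq_of_mem_range (Algebra.trace (ZMod p) F)
      (Algebra.trace_surjective _ _ _) (Algebra.trace_surjective _ _ _)
  have h := Finset.card_eq_sum_card_fiberwise (s := (Finset.univ : Finset F))
    (f := fun x : F => Algebra.trace (ZMod p) F x) (t := Finset.univ) (by intro x _; simp)
  rw [Finset.sum_congr rfl fun d _ => hf d, Finset.sum_const, Finset.card_univ, Finset.card_univ,
    ZMod.card, smul_eq_mul] at h
  have h2 := Finset.card_eq_sum_card_fiberwise
    (s := Finset.univ.filter (fun x : F => Algebra.trace (ZMod p) F x ∈ C))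
    (f := fun x : F => Algebra.trace (ZMod p) F x) (t := C) (by intro x hx; simpa using hx)
  have h3 : ∀ d ∈ C, (Finset.filter (fun x : F => Algebra.trace (ZMod p) F x = d)
      (Finset.univ.filter (fun x : F => Algebra.trace (ZMod p) F x ∈ C))).card =
      (Finset.univ.filter (fun x : F => Algebra.trace (ZMod p) F x = 0)).card := by
    intro d hd
    rw [← hf d, Finset.filter_filter]
    congr 1
    ext x
    simp only [Finset.mem_filter, Finset.mem_univ, true_and]
    exact ⟨fun h => h.2, fun h => ⟨h ▸ hd, h⟩⟩
  rw [Finset.sum_congr rfl h3, Finset.sum_const, smul_eq_mul] at h2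
  rw [h2, h]; ring

lemma cyc_card (hp : p % 4 = 3) (i : ℕ) : 2 * (cyc p i).card + 1 = p := by
  have h01 : (cyc p 0).card = (cyc p 1).card := by
    apply Finset.card_bij (fun x _ => -x)
    · intro x hx
      simp only [cyc, Finset.mem_filter, Finset.mem_univ, true_and, if_true, one_ne_zero,
        if_false] at hx ⊢
      refine ⟨neg_ne_zero.2 hx.1, fun h => not_sq_neg_one hp ?_⟩
      have := h.div hx.2
      rwa [neg_div, div_self hx.1] at this
    · intro x _ y _ h
      exact neg_injective h
    · intro y hy
      simp only [cyc, Finset.mem_filter, Finset.mem_univ, true_and, if_true, one_ne_zero,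
        if_false] at hy
      refine ⟨-y, ?_, neg_neg y⟩
      simp only [cyc, Finset.mem_filter, Finset.mem_univ, true_and, if_true]
      exact ⟨neg_ne_zero.2 hy.1, (sq_or_neg_sq hp y).resolve_left hy.2⟩
  have hs : (cyc p 0).card + (cyc p 1).card + 1 = p := by
    have h1 : Disjoint (cyc p 0) (cyc p 1) := by
      rw [Finset.disjoint_left]
      intro x hx hy
      simp only [cyc, Finset.mem_filter, Finset.mem_univ, true_and, if_true, one_ne_zero,
        if_false] at hx hy
      exact hy.2 hx.2
    have h2 : cyc p 0 ∪ cyc p 1 = Finset.univ.erase 0 := by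
      ext x
      simp only [cyc, Finset.mem_union, Finset.mem_filter, Finset.mem_univ, true_and, if_true,
        one_ne_zero, if_false, Finset.mem_erase, and_true]
      tauto
    rw [← Finset.card_union_of_disjoint h1, h2, Finset.card_erase_add_one (Finset.mem_univ _),
      Finset.card_univ, ZMod.card]
  have hi : (cyc p i).card = (cyc p 0).card := by
    by_cases h : i = 0
    · rw [h]
    · rw [h01]; congr 1; ext x; simp [cyc, h]
  omega

lemma nu_zero (hp : p % 4 = 3) (c : ZMod p) (hc : c = 0 ∨ c ∈ cyc p 0) :
    (Finset.univ.filter (fun u : ZMod p => c * u ^ 2 = -1)).card = 0 := by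
  rw [Finset.card_eq_zero, Finset.filter_eq_empty_iff]
  intro u _ h
  apply not_sq_neg_one hp
  rw [← h]
  refine IsSquare.mul ?_ ⟨u, sq u⟩
  rcases hc with rfl | hc
  · exact ⟨0, by simp⟩
  · simp only [cyc, Finset.mem_filter, Finset.mem_univ, true_and, if_true] at hc
    exact hc.2

lemma nu_two (hp : p % 4 = 3) (c : ZMod p) (hc : c ∈ cyc p 1) :
    (Finset.univ.filter (fun u : ZMod p => c * u ^ 2 = -1)).card = 2 := by
  simp only [cyc, Finset.mem_filter, Finset.mem_univ, true_and, one_ne_zero, if_false] at hc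
  obtain ⟨hc0, hc1⟩ := hc
  obtain ⟨w, hw⟩ := (sq_or_neg_sq hp c).resolve_left hc1
  have hw0 : w ≠ 0 := by rintro rfl; simp at hw; exact hc0 hw
  have hc' : c = -(w * w) := by rw [← hw, neg_neg]
  have h2 : (2 : ZMod p) ≠ 0 := by
    intro h
    have := (ZMod.natCast_eq_zero_iff 2 p).1 (by exact_mod_cast h)
    have := Nat.le_of_dvd (by norm_num) this
    omega
  have : (Finset.univ.filter (fun u : ZMod p => c * u ^ 2 = -1)) = {w⁻¹, -w⁻¹} := by
    ext u
    simp only [Finset.mem_filter, Finset.mem_univ, true_and, Finset.mem_insert,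
      Finset.mem_singleton]
    rw [← sq_eq_sq_iff_eq_or_eq_neg, hc']
    constructor
    · intro h
      field_simp
      linear_combination -h
    · intro h
      rw [h]; field_simp
  rw [this, Finset.card_pair]
  intro h
  have h3 : 2 * w⁻¹ = 0 := by linear_combination h
  rcases mul_eq_zero.1 h3 with h | h
  · exact h2 h
  · exact hw0 (inv_eq_zero.1 h)

end Helpers

lemma wt_eq_sub (p e l : ℕ) [Fact p.Prime] (i : ℕ) (a b : GaloisField p e) :
    wt (codeword p e l i a b) = Nat.card (Dset p e l i) - Tcount p e l i a b := by
  classical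
  have h1 := Nat.card_congr (Equiv.sumCompl (fun x : Dset p e l i => codeword p e l i a b x = 0))
  rw [Nat.card_sum] at h1
  have h2 : Tcount p e l i a b = Nat.card {x : Dset p e l i // codeword p e l i a b x = 0} := by
    apply Nat.card_congr
    exact
      { toFun := fun x => ⟨⟨x.1, x.2.1, x.2.2.1⟩, x.2.2.2⟩
        invFun := fun x => ⟨x.1.1, x.1.2.1, x.1.2.2, x.2⟩
        left_inv := fun x => rfl
        right_inv := fun x => rfl }
  rw [← h1, h2, wt]
  simp only [ne_eq]
  omega

open Classical in
lemma wt_eq_prod (p e l : ℕ) [Fact p.Prime] [Fintype (GaloisField p e)] (i : ℕ)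
    (a : GaloisField p e) :
    ∃ P : ℕ, wt (codeword p e l i a 0) = P * (Finset.univ.filter (fun x : GaloisField p e =>
      Algebra.trace (ZMod p) (GaloisField p e) x ∈ cyc p i)).card ∧
      P + (Finset.univ.filter (fun x : GaloisField p e => QF p l x = 1 ∧
        Algebra.trace (ZMod p) (GaloisField p e) (a * x) = 0)).card
        = NQ p (GaloisField p e) l 1 := by
  refine ⟨(Finset.univ.filter (fun x : GaloisField p e => QF p l x = 1 ∧
        ¬ Algebra.trace (ZMod p) (GaloisField p e) (a * x) = 0)).card, ?_, ?_⟩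
  · have h1 : wt (codeword p e l i a 0) =
        Nat.card ({x : GaloisField p e // QF p l x = 1 ∧
          ¬ Algebra.trace (ZMod p) (GaloisField p e) (a * x) = 0} ×
          {x : GaloisField p e // Algebra.trace (ZMod p) (GaloisField p e) x ∈ cyc p i}) := by
      apply Nat.card_congr
      exact
        { toFun := fun x => ⟨⟨x.1.1.1, x.1.2.1, by
              have := x.2
              simpa [codeword, tr] using this⟩, ⟨x.1.1.2, x.1.2.2⟩⟩
          invFun := fun x => ⟨⟨(x.1.1, x.2.1), x.1.2.1, x.2.2⟩, by
              have := x.1.2.2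
              simpa [codeword, tr] using this⟩
          left_inv := fun x => rfl
          right_inv := fun x => rfl }
    rw [h1, Nat.card_prod, Nat.card_eq_fintype_card, Nat.card_eq_fintype_card,
      Fintype.card_subtype, Fintype.card_subtype]
  · rw [NQ, ← Finset.filter_filter, ← Finset.filter_filter, add_comm]
    exact Finset.card_filter_add_card_filter_not _

/-- the Hamming weight of the codeword of `C_{D_i}` indexed by `(a, b)`
equals `n_i - T_i(a,b)`, and its value for `a ≠ 0`, `b = 0` when `m/s` is odd. -/
theorem codeword_weight (p e l m s : ℕ) [Fact p.Prime] (hp : p % 4 = 3)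
    (hl : 0 < l) (hm : 1 ≤ m) (he : e = 2 * m) (hs : s = Nat.gcd l e)
    (hsm : s ∣ m) (hodd : Odd (m / s)) :
    ∀ i ≤ 1, ∀ a b : GaloisField p e,
      wt (codeword p e l i a b) = Nat.card (Dset p e l i) - Tcount p e l i a b ∧
      (a ≠ 0 → b = 0 →
        (∃! γ : GaloisField p e, γ ^ p ^ (2 * l) + γ = -a ^ p ^ l) ∧
        ∀ γ : GaloisField p e, γ ^ p ^ (2 * l) + γ = -a ^ p ^ l →
          ((tr p e (γ ^ (p ^ l + 1)) = 0 ∨ tr p e (γ ^ (p ^ l + 1)) ∈ cyc p 0) →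
            (wt (codeword p e l i a b) : ℚ) =
              ((p : ℚ) - 1) ^ 2 / 2 * (p : ℚ) ^ (2 * e - 3)) ∧
          (tr p e (γ ^ (p ^ l + 1)) ∈ cyc p 1 →
            (wt (codeword p e l i a b) : ℚ) =
              ((p : ℚ) - 1) ^ 2 / 2 * (p : ℚ) ^ (2 * e - 3) +
                ((p : ℚ) - 1) * (p : ℚ) ^ (e + m - 2))) := by
  have hp2 : p ≠ 2 := by rintro rfl; omega
  have hs0 : 0 < s := by rw [hs]; exact Nat.gcd_pos_of_pos_left _ hl
  obtain ⟨l', hl'⟩ : s ∣ l := by rw [hs]; exact Nat.gcd_dvd_left _ _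
  obtain ⟨m', hm'⟩ := hsm
  have hm'o : Odd m' := by rwa [hm', Nat.mul_div_cancel_left _ hs0] at hodd
  have hl'o : Odd l' := by
    by_contra h
    rw [Nat.not_odd_iff_even] at h
    obtain ⟨r, hr⟩ := h
    have h1 : s * 2 ∣ Nat.gcd l e :=
      Nat.dvd_gcd ⟨r, by rw [hl', hr]; ring⟩ ⟨m', by rw [he, hm']; ring⟩
    rw [← hs] at h1
    have := Nat.le_of_dvd hs0 h1
    omega
  letI : Fintype (GaloisField p e) := Fintype.ofFinite _
  have hcard : Fintype.card (GaloisField p e) = p ^ (2 * m) := by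
    rw [← Nat.card_eq_fintype_card, GaloisField.card p e (by omega), he]
  have hnd : ∀ x : GaloisField p e, x ^ p ^ (2 * l) = -x → x = 0 :=
    lin_nondeg hp2 l e m' l' (by rw [hcard, he]) hm'o (by rw [he, hl', hm']; ring)
  obtain ⟨hN, hS⟩ := S_value (F := GaloisField p e) hp l s m m' l' hs0 hm'o hl'o hm' hl' hcard hnd
  have hSz : ∀ z : ZMod p, z ≠ 0 →
      ∑ x : GaloisField p e, ZMod.stdAddChar (z * QF p l x) = -(p : ℂ) ^ m := by
    intro z hz
    rw [sum_char_Q l hN z hz, hS]; push_cast; rfl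
  intro i _ a b
  refine ⟨wt_eq_sub p e l i a b, ?_⟩
  intro ha hb
  refine ⟨lin_bij l hnd _, ?_⟩
  intro γ hγ
  subst hb
  have hM := count_M l m a γ ha hγ hSz
  have hsum := NQ_sum l hN
  have hw := wt_eq_prod p e l i a
  have hA := trace_fiber (F := GaloisField p e) (cyc p i)
  have hc := cyc_card hp i
  rw [hcard] at hM hsum hA
  set M := (Finset.univ.filter (fun x : GaloisField p e => QF p l x = 1 ∧
        Algebra.trace (ZMod p) (GaloisField p e) (a * x) = 0)).card
  set A := (Finset.univ.filter (fun x : GaloisField p e =>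
    Algebra.trace (ZMod p) (GaloisField p e) x ∈ cyc p i)).card
  set n1 := NQ p (GaloisField p e) l 1
  set n0 := NQ p (GaloisField p e) l 0
  set k := (cyc p i).card
  set W := wt (codeword p e l i a 0)
  obtain ⟨P, hP, hPM⟩ := hw
  have hp0 : (p : ℚ) ≠ 0 := by exact_mod_cast (Fact.out : p.Prime).ne_zero
  have main : ∀ n : ℕ, (Finset.univ.filter (fun u : ZMod p => QF p l γ * u ^ 2 = -1)).card = n →
      (p : ℚ) ^ 3 * W = ((p - 1) * p ^ (2 * m) + p ^ (m + 1) * n) * p ^ (2 * m) * ((p - 1) / 2) := by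
    intro n hn
    rw [hn] at hM
    have q1 : (p : ℚ) ^ 2 * M = p ^ (2 * m) - p ^ m * (p * n - p) := by exact_mod_cast hM
    have q2 : (n0 : ℚ) + (p - 1) * n1 = p ^ (2 * m) := by exact_mod_cast hsum
    have q3 : (n0 : ℚ) - n1 = - p ^ m := by exact_mod_cast hS
    have q4 : (p : ℚ) * A = k * p ^ (2 * m) := by exact_mod_cast hA
    have q5 : 2 * (k : ℚ) + 1 = p := by exact_mod_cast hc
    have q6 : (W : ℚ) = P * A := by exact_mod_cast hP
    have q7 : (P : ℚ) + M = n1 := by exact_mod_cast hPM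
    have q8 : (p : ℚ) * n1 = p ^ (2 * m) + p ^ m := by linear_combination q2 - q3
    have q9 : (p : ℚ) ^ 2 * P = (p - 1) * p ^ (2 * m) + p ^ (m + 1) * n := by
      rw [pow_succ _ m]
      linear_combination (p : ℚ) ^ 2 * q7 - q1 + p * q8
    have q10 : (k : ℚ) = (p - 1) / 2 := by linear_combination q5 / 2
    rw [q6, ← q9, ← q10]
    linear_combination (p : ℚ) ^ 2 * P * q4
  have hexp : (p : ℚ) ^ (2 * e - 3) * p ^ 3 = p ^ (2 * m) * p ^ (2 * m) := by
    rw [← pow_add, ← pow_add]; congr 1; omega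
  have hexp2 : (p : ℚ) ^ (e + m - 2) * p ^ 3 = p ^ (m + 1) * p ^ (2 * m) := by
    rw [← pow_add, ← pow_add]; congr 1; omega
  have hp3 : (p : ℚ) ^ 3 ≠ 0 := pow_ne_zero _ hp0
  constructor
  · intro h
    have h1 := main 0 (nu_zero hp _ h)
    apply mul_left_cancel₀ hp3
    rw [h1]
    push_cast
    linear_combination -((p : ℚ) - 1) ^ 2 / 2 * hexp
  · intro h
    have h1 := main 2 (nu_two hp _ h)
    apply mul_left_cancel₀ hp3
    rw [h1]
    push_cast
    linear_combination -((p : ℚ) - 1) ^ 2 / 2 * hexp - ((p : ℚ) - 1) * hexp2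

end
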